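/- Let X be a compact metric space equipped with a Borel probability measure dx, let N₁, N₂ ≥ 1, and let x₁, …, x_{N₁} and y₁, …, y_{N₂} be points of X. Set A = (1/(N₁+N₂)) (∑_{i=1}^{N₁} δ_{x_i} − ∑_{j=1}^{N₂} δ_{y_j}) and B = (1/(N₁+N₂)) (∑_{i=1}^{N₁} δ_{x_i} + ∑_{j=1}^{N₂} δ_{y_j}). Then 𝐖₁^{1,1}(A, dx) ≤ 2N₂/(N₁+N₂) + W₁(B, dx). -/

import Mathlib

open MeasureTheory Filter Metric
open scoped ENNReal

section Defs

variable {X : Type*} [MeasurableSpace X] [MetricSpace X]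

/-- A transference plan (coupling) between `μ` and `ν`: a measure on `X × X`
whose marginals are `μ` and `ν`. -/
def IsCoupling (μ ν : Measure X) (π : Measure (X × X)) : Prop :=
  π.map Prod.fst = μ ∧ π.map Prod.snd = ν

/-- The 1-Wasserstein distance between two (nonnegative) measures of equal mass:
the infimum over couplings of the transport cost. -/
noncomputable def W1 (μ ν : Measure X) : ℝ :=
  sInf { r : ℝ | ∃ π : Measure (X × X), IsCoupling μ ν π ∧
    r = ∫ p : X × X, dist p.1 p.2 ∂π }

/-- The total variation norm `‖μ - ν‖` of the difference of two finite measures. -/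
noncomputable def tvNorm (μ ν : Measure X) : ℝ :=
  ((μ - ν) Set.univ + (ν - μ) Set.univ).toReal

/-- The generalized Wasserstein distance `W₁^{a,b}` between two finite nonnegative
measures, possibly of different total mass (Piccoli–Rossi). -/
noncomputable def genW (a b : ℝ) (μ ν : Measure X) : ℝ :=
  sInf { r : ℝ | ∃ μ' ν' : Measure X, IsFiniteMeasure μ' ∧ IsFiniteMeasure ν' ∧
    μ' Set.univ = ν' Set.univ ∧
    r = a * (tvNorm μ μ' + tvNorm ν ν') + b * W1 μ' ν' }

/-- The signed generalized Wasserstein distance `𝐖₁^{a,b}` between finite signed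
measures, defined via the Jordan decompositions. -/
noncomputable def signedW (a b : ℝ) (μ ν : SignedMeasure X) : ℝ :=
  genW a b (μ.toJordanDecomposition.posPart + ν.toJordanDecomposition.negPart)
    (μ.toJordanDecomposition.negPart + ν.toJordanDecomposition.posPart)

/-- The empirical (probability) measure of the first `n` points of a sequence. -/
noncomputable def emp (x : ℕ → X) (n : ℕ) : Measure X :=
  (n : ℝ≥0∞)⁻¹ • ∑ k ∈ Finset.range n, Measure.dirac (x k)

/-- The (unnormalized) empirical signed measure of the first `n` points of a sequence. -/
noncomputable def sEmp (x : ℕ → X) (n : ℕ) : SignedMeasure X :=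
  ∑ k ∈ Finset.range n, (Measure.dirac (x k)).toSignedMeasure

end Defs

section Helpers

variable {X : Type*} [MeasurableSpace X]

theorem exists_toSignedMeasure_eq_inv_smul_sum_dirac {ι : Type*} (s : Finset ι) (x : ι → X)
    (N : ℕ) (hN : N ≠ 0) :
    ∃ P : Measure X, ∃ _ : IsFiniteMeasure P,
      P = (N : ℝ≥0∞)⁻¹ • ∑ i ∈ s, Measure.dirac (x i) ∧
      P.toSignedMeasure = (N : ℝ)⁻¹ • ∑ i ∈ s, (Measure.dirac (x i)).toSignedMeasure := by
  have hfin : IsFiniteMeasure ((N : ℝ≥0∞)⁻¹ • ∑ i ∈ s, Measure.dirac (x i)) :=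
    Measure.smul_finite _ (by simp [hN])
  refine ⟨_, hfin, rfl, ?_⟩
  ext t ht
  simp only [Measure.toSignedMeasure_apply_measurable ht, smul_apply,
    measureReal_ennreal_smul_apply, ENNReal.toReal_inv, ENNReal.toReal_natCast, smul_eq_mul]
  congr 1
  rw [Measure.real, Measure.finsetSum_apply, ENNReal.toReal_sum fun _ _ => measure_ne_top _ _]
  simp [ht, Measure.real]

theorem tvNorm_comm [MetricSpace X] (μ ν : Measure X) : tvNorm μ ν = tvNorm ν μ := by
  rw [tvNorm, tvNorm, add_comm]

theorem tvNorm_nonneg [MetricSpace X] (μ ν : Measure X) : 0 ≤ tvNorm μ ν :=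
  ENNReal.toReal_nonneg

theorem W1_nonneg [MetricSpace X] (μ ν : Measure X) : 0 ≤ W1 μ ν := by
  refine Real.sInf_nonneg ?_
  rintro _ ⟨π, -, rfl⟩
  exact integral_nonneg fun _ => dist_nonneg

theorem tvNorm_of_le [MetricSpace X] {μ ν : Measure X} [IsFiniteMeasure μ] [IsFiniteMeasure ν]
    (h : μ ≤ ν) : tvNorm μ ν = ν.real Set.univ - μ.real Set.univ := by
  rw [tvNorm, Measure.sub_eq_zero_of_le h, Measure.sub_apply MeasurableSet.univ h,
    Measure.coe_zero, Pi.zero_apply, zero_add,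
    ENNReal.toReal_sub_of_le (h Set.univ) (measure_ne_top _ _), Measure.real, Measure.real]

theorem genW_le [MetricSpace X] {a b : ℝ} (ha : 0 ≤ a) (hb : 0 ≤ b) (μ ν μ' ν' : Measure X)
    [IsFiniteMeasure μ'] [IsFiniteMeasure ν'] (h : μ' Set.univ = ν' Set.univ) :
    genW a b μ ν ≤ a * (tvNorm μ μ' + tvNorm ν ν') + b * W1 μ' ν' := by
  refine csInf_le ⟨0, ?_⟩ ⟨μ', ν', inferInstance, inferInstance, h, rfl⟩
  rintro _ ⟨μ₁, ν₁, -, -, -, rfl⟩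
  have := tvNorm_nonneg μ μ₁
  have := tvNorm_nonneg ν ν₁
  have := W1_nonneg μ₁ ν₁
  positivity

theorem signedW_sub_le [MetricSpace X] (P Q ρ : Measure X) [IsFiniteMeasure P]
    [IsFiniteMeasure Q] [IsFiniteMeasure ρ] (h : (P + Q) Set.univ = ρ Set.univ) :
    signedW 1 1 (P.toSignedMeasure - Q.toSignedMeasure) ρ.toSignedMeasure ≤
      2 * Q.real Set.univ + W1 (P + Q) ρ := by
  have hρ : ρ.toSignedMeasure =
      ρ.toSignedMeasure - (0 : Measure X).toSignedMeasure := by simp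
  rw [signedW, hρ, Measure.toJordanDecomposition_toSignedMeasure_sub,
    Measure.toJordanDecomposition_toSignedMeasure_sub]
  simp only [Measure.jordanDecompositionOfToSignedMeasureSub_posPart,
    Measure.jordanDecompositionOfToSignedMeasureSub_negPart, Measure.sub_zero,
    Measure.zero_sub, add_zero]
  refine (genW_le zero_le_one zero_le_one _ _ (P + Q) ρ h).trans ?_
  rw [tvNorm_of_le (Measure.sub_le.trans (Measure.le_add_right le_rfl)), tvNorm_comm (Q - P + ρ),
    tvNorm_of_le (Measure.le_add_left le_rfl), measureReal_add_apply, measureReal_add_apply]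
  have key := congrArg (fun s : SignedMeasure X => s Set.univ)
    (Measure.sub_toSignedMeasure_eq_toSignedMeasure_sub (μ := P) (ν := Q))
  simp only [Measure.toSignedMeasure_sub_apply MeasurableSet.univ] at key
  linarith

end Helpers

/-- With `A = (1/(N₁+N₂))(∑δ_{x_i} − ∑δ_{y_j})` and
`B = (1/(N₁+N₂))(∑δ_{x_i} + ∑δ_{y_j})`, one has
`𝐖₁^{1,1}(A, dx) ≤ 2N₂/(N₁+N₂) + W₁(B, dx)`. -/
theorem signedW_le_two_N₂_add_W1 {X : Type*} [MeasurableSpace X] [MetricSpace X]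
    [BorelSpace X] [CompactSpace X] (dx : Measure X) [IsProbabilityMeasure dx]
    (N₁ N₂ : ℕ) (h₁ : 1 ≤ N₁) (h₂ : 1 ≤ N₂) (x : Fin N₁ → X) (y : Fin N₂ → X) :
    signedW 1 1
      (((N₁ + N₂ : ℕ) : ℝ)⁻¹ •
        (∑ i : Fin N₁, (Measure.dirac (x i)).toSignedMeasure
          - ∑ j : Fin N₂, (Measure.dirac (y j)).toSignedMeasure))
      dx.toSignedMeasure ≤
    2 * (N₂ : ℝ) / ((N₁ : ℝ) + N₂)
      + W1 (((N₁ + N₂ : ℕ) : ℝ≥0∞)⁻¹ •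
          (∑ i : Fin N₁, Measure.dirac (x i) + ∑ j : Fin N₂, Measure.dirac (y j))) dx := by
  have hN : N₁ + N₂ ≠ 0 := by omega
  obtain ⟨P, hP, hPe, hPs⟩ := exists_toSignedMeasure_eq_inv_smul_sum_dirac Finset.univ x _ hN
  obtain ⟨Q, hQ, hQe, hQs⟩ := exists_toSignedMeasure_eq_inv_smul_sum_dirac Finset.univ y _ hN
  rw [smul_sub, ← hPs, ← hQs, smul_add, ← hPe, ← hQe]
  have hmass : (P + Q) Set.univ = dx Set.univ := by
    rw [hPe, hQe, ← smul_add]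
    simp only [Measure.smul_apply, Measure.add_apply, Measure.finsetSum_apply, measure_univ,
      Finset.sum_const, Finset.card_univ, Fintype.card_fin, nsmul_eq_mul, mul_one, smul_eq_mul]
    rw [← Nat.cast_add]
    exact ENNReal.inv_mul_cancel (by exact_mod_cast hN) (ENNReal.natCast_ne_top _)
  have hQu : Q.real Set.univ = (N₂ : ℝ) / (N₁ + N₂) := by
    rw [hQe, Measure.real]
    simp [div_eq_inv_mul, ENNReal.toReal_mul, -Nat.cast_add]
    simp
  refine (signedW_sub_le P Q dx hmass).trans_eq ?_
  rw [hQu, mul_div_assoc]
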